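/- The kernel of κ is a 3-dimensional F-subspace of ⋀²H containing no nonzero decomposable element; equivalently, if g, h ∈ H are linearly independent over F then (star g)·h ∉ F·1. (Thus C = ker κ is a plane external to the Klein quadric of P(H).) -/

import Mathlib

open ExteriorAlgebra
open scoped Quaternion

variable (F : Type*) [Field F] (V : Type*) [AddCommGroup V] [Module F V]

/-- An element of the second exterior power `⋀²V` is decomposable if it is the wedge
`u ∧ v` of two vectors of `V`. -/
def IsDecomposable (x : ⋀[F]^2 V) : Prop :=
  ∃ u v : V, (x : ExteriorAlgebra F V) = ι F u * ι F v

/-- The Plücker point `γM` of a line `M` of `P(V)`: the subspace of `⋀²V` spanned by all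
wedges `u ∧ v` with `u, v ∈ M`.  For a 2-dimensional `M` this is the 1-dimensional
subspace spanned by `u ∧ v`, where `{u, v}` is any basis of `M`. -/
def plueckerPoint (M : Submodule F V) : Submodule F ↥(⋀[F]^2 V) :=
  Submodule.span F {x : ⋀[F]^2 V | ∃ u ∈ M, ∃ v ∈ M, (x : ExteriorAlgebra F V) = ι F u * ι F v}

namespace QuaternionAlgebra

variable {F : Type*} [Field F] {c₁ c₂ c₃ : F}

/-- In a quaternion division algebra, `star g * h` is not a scalar when `g` and `h` are
linearly independent. -/
theorem star_mul_notMem_span_one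
    (hdiv : ∀ a : ℍ[F,c₁,c₂,c₃], a ≠ 0 → IsUnit a) {g h : ℍ[F,c₁,c₂,c₃]}
    (hgh : LinearIndependent F ![g, h]) :
    star g * h ∉ Submodule.span F {(1 : ℍ[F,c₁,c₂,c₃])} := by
  intro hmem
  obtain ⟨r, hr⟩ := Submodule.mem_span_singleton.1 hmem
  have hg : g ≠ 0 := hgh.ne_zero 0
  have hunit : IsUnit (star g) := hdiv _ (star_ne_zero.2 hg)
  set n : F := (star g * g).re with hn
  have hnorm : star g * g = n • (1 : ℍ[F,c₁,c₂,c₃]) := by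
    rw [star_mul_eq_coe, ← hn, ← coe_algebraMap, Algebra.algebraMap_eq_smul_one]
  have hn0 : n ≠ 0 := by
    intro h0
    rw [h0, zero_smul] at hnorm
    exact hg (hunit.mul_right_eq_zero.1 hnorm)
  have hdep : (-r) • g + n • h = 0 := by
    refine hunit.mul_right_eq_zero.1 ?_
    rw [mul_add, mul_smul_comm, mul_smul_comm, hnorm, ← hr, smul_smul, smul_smul, ← add_smul]
    simp [mul_comm]
  exact hn0 (LinearIndependent.pair_iff.1 hgh _ _ hdep).2

end QuaternionAlgebra

theorem linearIndependent_of_ι_mul_ι_ne_zero {F : Type*} [Field F] {V : Type*} [AddCommGroup V]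
    [Module F V] {u v : V} (huv : ι F u * ι F v ≠ 0) : LinearIndependent F ![u, v] := by
  have hu : u ≠ 0 := by
    rintro rfl
    simp at huv
  refine (LinearIndependent.pair_iff' hu).2 fun a hav => huv ?_
  rw [← hav, map_smul, mul_smul_comm, ι_sq_zero, smul_zero]

namespace QuaternionAlgebra

variable {F : Type*} [Field F] {c₁ c₂ c₃ : F}

/-- A linear map on the second exterior power of a quaternion algebra that sends `g ∧ h` to
`star g * h` modulo scalars has a 3-dimensional kernel. -/
theorem finrank_ker_of_wedge_eq_mk_star_mul
    (κ : ↥(⋀[F]^2 ℍ[F,c₁,c₂,c₃]) →ₗ[F]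
      (ℍ[F,c₁,c₂,c₃] ⧸ Submodule.span F {(1 : ℍ[F,c₁,c₂,c₃])}))
    (hκ : ∀ (g h : ℍ[F,c₁,c₂,c₃]) (x : ⋀[F]^2 ℍ[F,c₁,c₂,c₃]),
      (x : ExteriorAlgebra F ℍ[F,c₁,c₂,c₃]) = ι F g * ι F h →
        κ x = Submodule.Quotient.mk (star g * h)) :
    Module.finrank F (LinearMap.ker κ) = 3 := by
  have hsurj : LinearMap.range κ = ⊤ := by
    refine LinearMap.range_eq_top.2 fun q => ?_
    obtain ⟨h, rfl⟩ := Submodule.Quotient.mk_surjective _ q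
    refine ⟨exteriorPower.ιMulti F 2 ![1, h], ?_⟩
    rw [hκ 1 h _ (by simp [ExteriorAlgebra.ιMulti_apply]), star_one, one_mul]
  have hrank := κ.finrank_range_add_finrank_ker
  have hquot := (Submodule.span F {(1 : ℍ[F,c₁,c₂,c₃])}).finrank_quotient_add_finrank
  rw [finrank_span_singleton one_ne_zero, finrank_eq_four] at hquot
  rw [hsurj, finrank_top, exteriorPower.finrank_eq, finrank_eq_four,
    show Nat.choose 4 2 = 6 from rfl] at hrank
  omega

/-- The kernel of a linear map on the second exterior power of a quaternion division algebra that
sends `g ∧ h` to `star g * h` modulo scalars contains no nonzero decomposable element. -/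
theorem not_isDecomposable_of_mem_ker
    (hdiv : ∀ a : ℍ[F,c₁,c₂,c₃], a ≠ 0 → IsUnit a)
    (κ : ↥(⋀[F]^2 ℍ[F,c₁,c₂,c₃]) →ₗ[F]
      (ℍ[F,c₁,c₂,c₃] ⧸ Submodule.span F {(1 : ℍ[F,c₁,c₂,c₃])}))
    (hκ : ∀ (g h : ℍ[F,c₁,c₂,c₃]) (x : ⋀[F]^2 ℍ[F,c₁,c₂,c₃]),
      (x : ExteriorAlgebra F ℍ[F,c₁,c₂,c₃]) = ι F g * ι F h →
        κ x = Submodule.Quotient.mk (star g * h))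
    {x : ⋀[F]^2 ℍ[F,c₁,c₂,c₃]} (hx : x ∈ LinearMap.ker κ) (hx0 : x ≠ 0) :
    ¬ IsDecomposable F ℍ[F,c₁,c₂,c₃] x := by
  rintro ⟨u, v, hxuv⟩
  have huv : LinearIndependent F ![u, v] :=
    linearIndependent_of_ι_mul_ι_ne_zero (hxuv ▸ Subtype.coe_ne_coe.2 hx0)
  refine star_mul_notMem_span_one hdiv huv ?_
  rw [← Submodule.Quotient.mk_eq_zero, ← hκ u v x hxuv]
  exact hx

end QuaternionAlgebra

/-- `C = ker κ` is a plane external to the Klein quadric of `P(H)`, where `H` is a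
quaternion division algebra over `F` and `κ` is the linear map on `⋀²H` induced by
`(g, h) ↦ (star g)·h mod F·1`.  Equivalently, `(star g)·h ∉ F·1` whenever `g, h` are
linearly independent over `F`. -/
theorem ker_kappa_is_external_plane (c₁ c₂ : F)
    (hdiv : ∀ a : ℍ[F,c₁,c₂], a ≠ 0 → IsUnit a)
    (κ : ↥(⋀[F]^2 ℍ[F,c₁,c₂]) →ₗ[F]
      (ℍ[F,c₁,c₂] ⧸ Submodule.span F {(1 : ℍ[F,c₁,c₂])}))
    (hκ : ∀ (g h : ℍ[F,c₁,c₂]) (x : ⋀[F]^2 ℍ[F,c₁,c₂]),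
      (x : ExteriorAlgebra F ℍ[F,c₁,c₂]) = ι F g * ι F h →
        κ x = Submodule.Quotient.mk (star g * h)) :
    Module.finrank F (LinearMap.ker κ) = 3 ∧
    (∀ x ∈ LinearMap.ker κ, x ≠ 0 → ¬ IsDecomposable F ℍ[F,c₁,c₂] x) ∧
    (∀ g h : ℍ[F,c₁,c₂], LinearIndependent F ![g, h] →
      star g * h ∉ Submodule.span F {(1 : ℍ[F,c₁,c₂])}) :=
  ⟨QuaternionAlgebra.finrank_ker_of_wedge_eq_mk_star_mul κ hκ,
    fun _ => QuaternionAlgebra.not_isDecomposable_of_mem_ker hdiv κ hκ,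
    fun _ _ => QuaternionAlgebra.star_mul_notMem_span_one hdiv⟩
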